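/- Let 0 < s < 1 and Λ, δ > 0. The function ū satisfies ∫_{−δ}^0 (−Δ)^s ū(x) dx = 0. -/

import Mathlib

open MeasureTheory Filter Set Topology

noncomputable section

/-- A function `u : ℝ → ℝ` is piecewise affine: it is affine in a neighborhood of every
point outside a closed discrete set (the corner set). -/
def PiecewiseAffine (u : ℝ → ℝ) : Prop :=
  ∃ S : Set ℝ, IsClosed S ∧ (∀ x ∈ S, ∃ ε > 0, S ∩ Set.Ioo (x - ε) (x + ε) ⊆ {x}) ∧
    ∀ x ∉ S, ∃ ε > 0, ∃ m q : ℝ, ∀ y : ℝ, |y - x| < ε → u y = m * y + q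

/-- The admissible class `𝒜^{T,Λ,δ}`: continuous, `T`-periodic, piecewise affine functions
with slope in `{1, -Λ}` a.e., such that the region where the slope is `-Λ` is a union of
intervals of length `δ` whose pairwise intersections contain at most one point. -/
structure Admissible (T Λ δ : ℝ) (u : ℝ → ℝ) : Prop where
  cont : Continuous u
  per : Function.Periodic u T
  pwAffine : PiecewiseAffine u
  slopes : ∀ᵐ x : ℝ ∂volume, HasDerivAt u 1 x ∨ HasDerivAt u (-Λ) x
  negRegion : ∃ a : ℕ → ℝ,
    (∀ k : ℕ, Set.Ioo (a k) (a k + δ) ⊆ {x : ℝ | HasDerivAt u (-Λ) x}) ∧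
    ({x : ℝ | HasDerivAt u (-Λ) x} ⊆ ⋃ k : ℕ, Set.Icc (a k) (a k + δ)) ∧
    (Pairwise fun i j : ℕ =>
      (Set.Icc (a i) (a i + δ) ∩ Set.Icc (a j) (a j + δ)).Subsingleton)

/-- The `s`-fractional Gagliardo seminorm energy density
`ℱ^T_s(u) = (1/(2T)) ∫_0^T ∫_ℝ |u(x)-u(y)|²/|x-y|^{1+2s} dy dx`. -/
def Fs (s T : ℝ) (u : ℝ → ℝ) : ℝ :=
  (1 / (2 * T)) * ∫ x in Set.Ioo (0 : ℝ) T, ∫ y : ℝ, (u x - u y) ^ 2 / |x - y| ^ (1 + 2 * s)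

/-- The `s`-fractional Laplacian
`(-Δ)^s u (x) = 2 lim_{r→0⁺} ∫_{ℝ∖(x-r,x+r)} (u(x)-u(y))/|x-y|^{1+2s} dy`. -/
def fracLap (s : ℝ) (u : ℝ → ℝ) (x : ℝ) : ℝ :=
  limUnder (𝓝[>] (0 : ℝ)) fun r : ℝ =>
    2 * ∫ y in {y : ℝ | r ≤ |x - y|}, (u x - u y) / |x - y| ^ (1 + 2 * s)

/-- The function `ū`: the `(Λ+1)δ`-periodic function equal to `-Λx` on `(-δ,0)` and to
`x` on `[0,Λδ]`. -/
def ubar (Λ δ : ℝ) (x : ℝ) : ℝ :=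
  let y := ((Λ + 1) * δ) * Int.fract ((x + δ) / ((Λ + 1) * δ)) - δ
  if y < 0 then -Λ * y else y

/-- The extremal energy for `s = 0`: `ℱ^T_0(u) = (1/(2T)) ∫_0^T |u(x)|² dx`. -/
def F0 (T : ℝ) (u : ℝ → ℝ) : ℝ :=
  (1 / (2 * T)) * ∫ x in Set.Ioo (0 : ℝ) T, (u x) ^ 2

/-- The extremal energy for `s = 1`: `ℱ^T_1(u) = (1/(2T)) ∫_0^T |u'(x)|² dx`. -/
def F1 (T : ℝ) (u : ℝ → ℝ) : ℝ :=
  (1 / (2 * T)) * ∫ x in Set.Ioo (0 : ℝ) T, (deriv u x) ^ 2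

lemma ubar_of_mem_Ioo {Λ δ : ℝ} (hΛ : 0 < Λ) {x : ℝ} (hx : x ∈ Set.Ioo (-δ) 0) :
    ubar Λ δ x = -Λ * x := by
  obtain ⟨h1, h2⟩ := hx
  have hδ : 0 < δ := by linarith
  have hT : 0 < (Λ + 1) * δ := by positivity
  have hf : Int.fract ((x + δ) / ((Λ + 1) * δ)) = (x + δ) / ((Λ + 1) * δ) := by
    rw [Int.fract_eq_self]
    refine ⟨div_nonneg (by linarith) hT.le, ?_⟩
    rw [div_lt_one hT]
    nlinarith [mul_pos hΛ hδ]
  have hy : (Λ + 1) * δ * ((x + δ) / ((Λ + 1) * δ)) - δ = x := by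
    rw [mul_div_cancel₀ _ hT.ne']
    ring
  simp only [ubar, hf, hy, if_pos h2]

/-- The graph of `ū` is symmetric about the point `(-δ/2, Λδ/2)`. -/
lemma ubar_reflect {Λ δ : ℝ} (hΛ : 0 < Λ) (hδ : 0 < δ) (x : ℝ) :
    ubar Λ δ (-δ - x) = Λ * δ - ubar Λ δ x := by
  have hT : 0 < (Λ + 1) * δ := by positivity
  have hc : (Λ + 1) * δ * (δ / ((Λ + 1) * δ)) = δ := mul_div_cancel₀ _ hT.ne'
  have harg : (-δ - x + δ) / ((Λ + 1) * δ) =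
      δ / ((Λ + 1) * δ) - (x + δ) / ((Λ + 1) * δ) := by ring
  have hc1 : δ / ((Λ + 1) * δ) < 1 := by
    rw [div_lt_one hT]
    nlinarith [mul_pos hΛ hδ]
  have hc0 : 0 < δ / ((Λ + 1) * δ) := div_pos hδ hT
  simp only [ubar, harg]
  generalize δ / ((Λ + 1) * δ) = c at *
  generalize (x + δ) / ((Λ + 1) * δ) = t
  have hf0 := Int.fract_nonneg t
  have hf1 := Int.fract_lt_one t
  have hft := Int.floor_add_fract t
  generalize Int.fract t = f at *
  rcases le_or_gt f c with h | h
  · have hfr : Int.fract (c - t) = c - f := by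
      rw [Int.fract_eq_iff]
      exact ⟨by linarith, by linarith, -⌊t⌋, by push_cast; linarith⟩
    have hcf : (Λ + 1) * δ * f ≤ δ := by nlinarith
    have hf0' : 0 ≤ (Λ + 1) * δ * f := by positivity
    rw [hfr, mul_sub, hc]
    split_ifs <;> nlinarith
  · have hfr : Int.fract (c - t) = c - f + 1 := by
      rw [Int.fract_eq_iff]
      exact ⟨by linarith, by linarith, -⌊t⌋ - 1, by push_cast; linarith⟩
    have hcf : δ < (Λ + 1) * δ * f := by nlinarith
    have hf1' : (Λ + 1) * δ * f < (Λ + 1) * δ := by nlinarith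
    rw [hfr, mul_add, mul_sub, hc]
    split_ifs <;> nlinarith

lemma integral_truncated_kernel_reflect {u : ℝ → ℝ} {a b : ℝ}
    (hu : ∀ y, u (a - y) = b - u y) (p r x : ℝ) :
    ∫ y in {y : ℝ | r ≤ |a - x - y|}, (u (a - x) - u y) / |a - x - y| ^ p =
      -∫ y in {y : ℝ | r ≤ |x - y|}, (u x - u y) / |x - y| ^ p := by
  have h := (volume.measurePreserving_sub_left a).setIntegral_preimage_emb
    (MeasurableEquiv.subLeft a).measurableEmbedding
    (fun y => (u (a - x) - u y) / |a - x - y| ^ p) {y : ℝ | r ≤ |a - x - y|}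
  have habs (y : ℝ) : |a - x - (a - y)| = |x - y| := by
    rw [show a - x - (a - y) = -(x - y) by ring, abs_neg]
  rw [← h, ← integral_neg]
  simp only [Set.preimage_ofPred_eq, habs, hu]
  congr 1
  ext y
  ring

lemma setIntegral_annulus_eq_zero_of_affine {u : ℝ → ℝ} {x ε m q : ℝ}
    (hu : ∀ y, |x - y| < ε → u y = m * y + q) (hε : 0 < ε) (p r : ℝ) :
    ∫ y in {y : ℝ | r ≤ |x - y| ∧ |x - y| < ε}, (u x - u y) / |x - y| ^ p = 0 := by
  have h := (volume.measurePreserving_sub_left (2 * x)).setIntegral_preimage_emb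
    (MeasurableEquiv.subLeft (2 * x)).measurableEmbedding
    (fun y => (u x - u y) / |x - y| ^ p) {y : ℝ | r ≤ |x - y| ∧ |x - y| < ε}
  have habs (y : ℝ) : |x - (2 * x - y)| = |x - y| := by
    rw [show x - (2 * x - y) = -(x - y) by ring, abs_neg]
  simp only [Set.preimage_ofPred_eq, habs] at h
  have hmeas : MeasurableSet {y : ℝ | r ≤ |x - y| ∧ |x - y| < ε} := by measurability
  have hneg : ∫ y in {y : ℝ | r ≤ |x - y| ∧ |x - y| < ε}, (u x - u (2 * x - y)) / |x - y| ^ p =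
      ∫ y in {y : ℝ | r ≤ |x - y| ∧ |x - y| < ε}, -((u x - u y) / |x - y| ^ p) := by
    refine setIntegral_congr_fun hmeas fun y hy => ?_
    have hx := hu x (by simpa using hε)
    have h1 := hu y hy.2
    have h2 := hu (2 * x - y) (by rw [habs]; exact hy.2)
    simp only [hx, h1, h2]
    ring
  rw [hneg, integral_neg] at h
  linarith

lemma integrableOn_annulus_of_affine {u : ℝ → ℝ} {x ε m q : ℝ}
    (hu : ∀ y, |x - y| < ε → u y = m * y + q) (hε : 0 < ε) (p : ℝ) {r : ℝ} (hr : 0 < r) :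
    IntegrableOn (fun y => (u x - u y) / |x - y| ^ p)
      {y : ℝ | r ≤ |x - y| ∧ |x - y| < ε} := by
  have hmeas : MeasurableSet {y : ℝ | r ≤ |x - y| ∧ |x - y| < ε} := by measurability
  have hK : IsCompact {y : ℝ | r ≤ |x - y| ∧ |x - y| ≤ ε} := by
    refine (isCompact_closedBall x ε).of_isClosed_subset ?_ fun y hy => ?_
    · have hcont : Continuous fun y => |x - y| := by fun_prop
      exact (isClosed_le continuous_const hcont).inter (isClosed_le hcont continuous_const)
    · rw [Metric.mem_closedBall, dist_comm, Real.dist_eq]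
      exact hy.2
  have hcont : ContinuousOn (fun y => (m * x + q - (m * y + q)) / |x - y| ^ p)
      {y : ℝ | r ≤ |x - y| ∧ |x - y| ≤ ε} := by
    have hpos (y : ℝ) (hy : y ∈ {y : ℝ | r ≤ |x - y| ∧ |x - y| ≤ ε}) : 0 < |x - y| :=
      hr.trans_le hy.1
    refine ContinuousOn.div (by fun_prop) ?_ fun y hy => (Real.rpow_pos_of_pos (hpos y hy) p).ne'
    exact ContinuousOn.rpow_const (by fun_prop) fun y hy => Or.inl (hpos y hy).ne'
  refine ((hcont.integrableOn_compact hK).mono_set fun y hy => ⟨hy.1, hy.2.le⟩).congr_fun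
    (fun y hy => ?_) hmeas
  simp only [hu x (by simpa using hε), hu y hy.2]

/-- Near a point where `u` is affine, the truncated integrals do not depend on the truncation. -/
lemma integral_truncated_kernel_eq_of_affine {u : ℝ → ℝ} {x ε m q : ℝ}
    (hu : ∀ y, |x - y| < ε → u y = m * y + q) (p : ℝ) {r : ℝ} (hr : 0 < r) (hrε : r < ε) :
    ∫ y in {y : ℝ | r ≤ |x - y|}, (u x - u y) / |x - y| ^ p =
      ∫ y in {y : ℝ | ε ≤ |x - y|}, (u x - u y) / |x - y| ^ p := by
  have hε := hr.trans hrε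
  have hset : {y : ℝ | r ≤ |x - y|} =
      {y : ℝ | r ≤ |x - y| ∧ |x - y| < ε} ∪ {y : ℝ | ε ≤ |x - y|} := by
    ext y
    simp only [Set.mem_union, Set.mem_ofPred_eq]
    grind
  have hdisj : Disjoint {y : ℝ | r ≤ |x - y| ∧ |x - y| < ε} {y : ℝ | ε ≤ |x - y|} :=
    Set.disjoint_left.2 fun y hy hy' => absurd hy.2 (not_lt.2 hy')
  have hmeas : MeasurableSet {y : ℝ | ε ≤ |x - y|} := by measurability
  have hann := integrableOn_annulus_of_affine hu hε p hr
  rw [hset]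
  by_cases hint : IntegrableOn (fun y => (u x - u y) / |x - y| ^ p) {y : ℝ | ε ≤ |x - y|}
  · rw [setIntegral_union hdisj hmeas hann hint,
      setIntegral_annulus_eq_zero_of_affine hu hε, zero_add]
  · rw [integral_undef hint, integral_undef fun h => hint (integrableOn_union.1 h).2]

lemma tendsto_fracLap_of_affine {u : ℝ → ℝ} {x ε m q : ℝ} (hε : 0 < ε)
    (hu : ∀ y, |x - y| < ε → u y = m * y + q) (s : ℝ) :
    Tendsto (fun r : ℝ => 2 * ∫ y in {y : ℝ | r ≤ |x - y|}, (u x - u y) / |x - y| ^ (1 + 2 * s))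
      (𝓝[>] 0) (𝓝 (fracLap s u x)) := by
  refine tendsto_nhds_limUnder
    ⟨2 * ∫ y in {y : ℝ | ε ≤ |x - y|}, (u x - u y) / |x - y| ^ (1 + 2 * s), ?_⟩
  refine tendsto_const_nhds.congr' ?_
  filter_upwards [Ioo_mem_nhdsGT hε] with r hr
  rw [integral_truncated_kernel_eq_of_affine hu _ hr.1 hr.2]

lemma fracLap_reflect_of_affine {u : ℝ → ℝ} {a b x ε m q : ℝ} (hε : 0 < ε)
    (hu : ∀ y, |x - y| < ε → u y = m * y + q) (hsymm : ∀ y, u (a - y) = b - u y) (s : ℝ) :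
    fracLap s u (a - x) = -fracLap s u x := by
  refine ((tendsto_fracLap_of_affine hε hu s).neg.congr fun r => ?_).limUnder_eq
  rw [integral_truncated_kernel_reflect hsymm]
  ring

/-- The fractional Laplacian of `ū` has zero average on `(-δ, 0)`. -/
theorem statement1 (s Λ δ : ℝ) (hs : 0 < s) (hs1 : s < 1) (hΛ : 0 < Λ) (hδ : 0 < δ) :
    ∫ x in Set.Ioo (-δ) (0 : ℝ), fracLap s (ubar Λ δ) x = 0 := by
  have hodd (x : ℝ) (hx : x ∈ Set.Ioo (-δ) 0) :
      fracLap s (ubar Λ δ) (-δ - x) = -fracLap s (ubar Λ δ) x := by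
    have hε : 0 < min (x + δ) (-x) := lt_min (by linarith [hx.1]) (by linarith [hx.2])
    refine fracLap_reflect_of_affine (m := -Λ) (q := 0) hε (fun y hy => ?_)
      (ubar_reflect hΛ hδ) s
    obtain ⟨h1, h2⟩ := lt_min_iff.1 hy
    rw [abs_lt] at h1 h2
    rw [add_zero, ubar_of_mem_Ioo hΛ ⟨by linarith, by linarith⟩]
  have h := (volume.measurePreserving_sub_left (-δ)).setIntegral_preimage_emb
    (MeasurableEquiv.subLeft (-δ)).measurableEmbedding
    (fracLap s (ubar Λ δ)) (Set.Ioo (-δ) 0)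
  rw [Set.preimage_const_sub_Ioo, sub_zero, sub_self,
    setIntegral_congr_fun measurableSet_Ioo hodd, integral_neg] at h
  linarith
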